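/- Let S = (X, Y, Z, W) be the M₄(2,3) balanced excited random walk, let τ_0 = 0 and τ_k := inf{n > τ_{k−1} : (Z_n, W_n) ≠ (Z_{n−1}, W_{n−1})} for k ≥ 1, and set M_m := X_{τ_m}. Then all τ_k are almost surely finite, and under the law P_U of S conditioned on the whole process U_k = (Z_{τ_k}, W_{τ_k}), the process (M_m : m ≥ 0) is a martingale with respect to the filtration 𝒢_m := 𝔽_{τ_m}, where 𝔽_n is the σ-algebra generated by the first n increments of S. -/

import Mathlib

open MeasureTheory Filter

/-- The `i`-th canonical unit vector of `ℤ^d`. -/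
def unitVec (d : ℕ) (i : Fin d) : Fin d → ℤ := fun j => if j = i then 1 else 0

/-- `S` is a balanced excited random walk `M_d(d₁,d₂)` under `P`:
it starts at `0` a.s., is measurable, and conditionally on any finite trajectory
`S_0 = h 0, …, S_n = h n`, if `h n` is a new site the walk jumps to `h n ± e_i`
with probability `1/(2d₁)` for each `i < d₁` (`0`-indexed), while if `h n` is an
old site it jumps to `h n ± e_i` with probability `1/(2d₂)` for each
`d - d₂ ≤ i < d` (`0`-indexed). -/
def IsBERW {Ω : Type*} [MeasurableSpace Ω] (d d₁ d₂ : ℕ) (P : Measure Ω)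
    (S : ℕ → Ω → Fin d → ℤ) : Prop :=
  (∀ n, Measurable (S n)) ∧
  (∀ᵐ ω ∂P, S 0 ω = 0) ∧
  (∀ (n : ℕ) (h : ℕ → Fin d → ℤ), (∀ k < n, h n ≠ h k) →
    ∀ i : Fin d, i.1 < d₁ → ∀ ε : ℤ, ε = 1 ∨ ε = -1 →
      P {ω | (∀ k ≤ n, S k ω = h k) ∧ S (n + 1) ω = h n + ε • unitVec d i}
        = P {ω | ∀ k ≤ n, S k ω = h k} / (2 * d₁)) ∧
  (∀ (n : ℕ) (h : ℕ → Fin d → ℤ), (∃ k < n, h n = h k) →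
    ∀ i : Fin d, d - d₂ ≤ i.1 → ∀ ε : ℤ, ε = 1 ∨ ε = -1 →
      P {ω | (∀ k ≤ n, S k ω = h k) ∧ S (n + 1) ω = h n + ε • unitVec d i}
        = P {ω | ∀ k ≤ n, S k ω = h k} / (2 * d₂))

/-- Transience: almost surely, every site is visited only finitely many times. -/
def IsTransientWalk {Ω : Type*} [MeasurableSpace Ω] (d : ℕ) (P : Measure Ω)
    (S : ℕ → Ω → Fin d → ℤ) : Prop :=
  ∀ᵐ ω ∂P, ∀ x : Fin d → ℤ, {n : ℕ | S n ω = x}.Finite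

/-- `τ_k`: the successive times at which the pair of the last two coordinates
`(Z, W)` of the walk moves (`τ_0 = 0`). -/
noncomputable def tau {Ω : Type*} (S : ℕ → Ω → Fin 4 → ℤ) : ℕ → Ω → ℕ
  | 0 => fun _ => 0
  | k + 1 => fun ω => sInf {n : ℕ | tau S k ω < n ∧
      ¬(S n ω 2 = S (n - 1) ω 2 ∧ S n ω 3 = S (n - 1) ω 3)}

/-- `M_m := X_{τ_m}`, the first coordinate of the walk observed at the times `τ`. -/
noncomputable def MartM {Ω : Type*} (S : ℕ → Ω → Fin 4 → ℤ) (m : ℕ) (ω : Ω) : ℝ :=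
  (S (tau S m ω) ω 0 : ℝ)

/-- The integer valued version of `M_m = X_{τ_m}`. -/
noncomputable def MartMZ {Ω : Type*} (S : ℕ → Ω → Fin 4 → ℤ) (m : ℕ) (ω : Ω) : ℤ :=
  S (tau S m ω) ω 0

/-- `U_k := (Z_{τ_k}, W_{τ_k})`, a simple symmetric random walk on `ℤ²`. -/
noncomputable def Uproc {Ω : Type*} (S : ℕ → Ω → Fin 4 → ℤ) (k : ℕ) (ω : Ω) : ℤ × ℤ :=
  (S (tau S k ω) ω 2, S (tau S k ω) ω 3)

/-- The σ-algebra generated by the whole process `U`; conditional expectation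
given it realizes conditioning on `U` (the conditional law `P_U`). -/
noncomputable def sigmaU {Ω : Type*} [MeasurableSpace Ω]
    (S : ℕ → Ω → Fin 4 → ℤ) : MeasurableSpace Ω :=
  MeasurableSpace.comap (fun ω => fun k : ℕ => Uproc S k ω) inferInstance

/-- `𝒢_m = 𝔽_{τ_m}`: the σ-algebra generated by the trajectory of the walk
stopped at `τ_m` (together with `τ_m`), i.e. the natural filtration of `S`
sampled at the stopping time `τ_m`. -/
noncomputable def stoppedSigma {Ω : Type*} [MeasurableSpace Ω]
    (S : ℕ → Ω → Fin 4 → ℤ) (m : ℕ) : MeasurableSpace Ω :=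
  MeasurableSpace.comap
    (fun ω => (tau S m ω, fun k : ℕ => S (min k (tau S m ω)) ω)) inferInstance

namespace BERW

/-- Sites of `ℤ⁴`. -/
abbrev Site := Fin 4 → ℤ

/-- The projection of a site on its last two coordinates. -/
def zw (x : Site) : ℤ × ℤ := (x 2, x 3)

/-- The steps available from a new site. -/
def newMoves : Finset Site :=
  {![1, 0, 0, 0], ![-1, 0, 0, 0], ![0, 1, 0, 0], ![0, -1, 0, 0]}

/-- The steps available from an old site. -/
def oldMoves : Finset Site :=
  {![0, 1, 0, 0], ![0, -1, 0, 0], ![0, 0, 1, 0], ![0, 0, -1, 0], ![0, 0, 0, 1], ![0, 0, 0, -1]}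

/-- The path `p` is at an old site at time `n`. -/
def IsOld (p : ℕ → Site) (n : ℕ) : Prop := ∃ k < n, p n = p k

open Classical in
/-- The steps available to the path `p` at time `n`. -/
noncomputable def moves (p : ℕ → Site) (n : ℕ) : Finset Site :=
  if IsOld p n then oldMoves else newMoves

/-- The number of moves of the last two coordinates of `p` up to time `n`. -/
def cnt (p : ℕ → Site) : ℕ → ℕ
  | 0 => 0
  | n + 1 => cnt p n + if zw (p (n + 1)) = zw (p n) then 0 else 1

theorem sum_newMoves (f : Site → ℝ) : ∑ e ∈ newMoves, f e =
    f ![1, 0, 0, 0] + f ![-1, 0, 0, 0] + f ![0, 1, 0, 0] + f ![0, -1, 0, 0] := by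
  rw [newMoves, Finset.sum_insert (by decide), Finset.sum_insert (by decide),
    Finset.sum_insert (by decide), Finset.sum_singleton]
  ring

theorem sum_oldMoves (f : Site → ℝ) : ∑ e ∈ oldMoves, f e =
    f ![0, 1, 0, 0] + f ![0, -1, 0, 0] + f ![0, 0, 1, 0] + f ![0, 0, -1, 0]
      + f ![0, 0, 0, 1] + f ![0, 0, 0, -1] := by
  rw [oldMoves, Finset.sum_insert (by decide), Finset.sum_insert (by decide),
    Finset.sum_insert (by decide), Finset.sum_insert (by decide),
    Finset.sum_insert (by decide), Finset.sum_singleton]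
  ring

theorem card_newMoves : newMoves.card = 4 := by decide

theorem card_oldMoves : oldMoves.card = 6 := by decide

theorem moves_nonempty (p : ℕ → Site) (n : ℕ) : (moves p n).Nonempty := by
  unfold moves
  split_ifs
  · exact ⟨![0, 1, 0, 0], by decide⟩
  · exact ⟨![0, 1, 0, 0], by decide⟩

theorem isOld_congr {p q : ℕ → Site} {n : ℕ} (h : ∀ k ≤ n, p k = q k) :
    IsOld p n ↔ IsOld q n := by
  unfold IsOld
  constructor
  · rintro ⟨k, hk, e⟩
    exact ⟨k, hk, by rw [← h n le_rfl, ← h k hk.le, e]⟩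
  · rintro ⟨k, hk, e⟩
    exact ⟨k, hk, by rw [h n le_rfl, h k hk.le, e]⟩

theorem moves_congr {p q : ℕ → Site} {n : ℕ} (h : ∀ k ≤ n, p k = q k) :
    moves p n = moves q n := by
  classical
  exact if_congr (isOld_congr h) rfl rfl

theorem cnt_congr {p q : ℕ → Site} {n : ℕ} (h : ∀ k ≤ n, p k = q k) :
    cnt p n = cnt q n := by
  induction n with
  | zero => rfl
  | succ n ih =>
    simp only [cnt]
    rw [ih fun k hk => h k (by omega), h (n + 1) le_rfl, h n (by omega)]

/-- The one-step transition probabilities of the walk. -/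
theorem measure_step {Ω : Type*} [MeasurableSpace Ω] {P : Measure Ω}
    {S : ℕ → Ω → Site} (hS : IsBERW 4 2 3 P S) (n : ℕ) (h : ℕ → Site) {e : Site}
    (he : e ∈ moves h n) :
    P {ω | (∀ k ≤ n, S k ω = h k) ∧ S (n + 1) ω = h n + e}
      = P {ω | ∀ k ≤ n, S k ω = h k} / ((moves h n).card : ENNReal) := by
  obtain ⟨-, -, hnew, hold⟩ := hS
  have hu : ∀ (i : Fin 4) (ε : ℤ), ε • unitVec 4 i = fun j => if j = i then ε else 0 := by
    intro i ε
    ext j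
    simp [unitVec]
  by_cases ho : IsOld h n
  · have hm : moves h n = oldMoves := if_pos ho
    rw [hm] at he ⊢
    rw [card_oldMoves]
    have key := hold n h ho
    have h6 : (2 * ((3 : ℕ) : ENNReal)) = ((6 : ℕ) : ENNReal) := by norm_num
    rw [h6] at key
    simp only [hu] at key
    simp only [oldMoves, Finset.mem_insert, Finset.mem_singleton] at he
    rcases he with rfl | rfl | rfl | rfl | rfl | rfl
    · convert key 1 (by decide) 1 (by decide) using 7; decide
    · convert key 1 (by decide) (-1) (by decide) using 7; decide
    · convert key 2 (by decide) 1 (by decide) using 7; decide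
    · convert key 2 (by decide) (-1) (by decide) using 7; decide
    · convert key 3 (by decide) 1 (by decide) using 7; decide
    · convert key 3 (by decide) (-1) (by decide) using 7; decide
  · have hm : moves h n = newMoves := if_neg ho
    rw [hm] at he ⊢
    rw [card_newMoves]
    have key := hnew n h (by simpa [IsOld] using ho)
    have h4 : (2 * ((2 : ℕ) : ENNReal)) = ((4 : ℕ) : ENNReal) := by norm_num
    rw [h4] at key
    simp only [hu] at key
    simp only [newMoves, Finset.mem_insert, Finset.mem_singleton] at he
    rcases he with rfl | rfl | rfl | rfl
    · convert key 0 (by decide) 1 (by decide) using 7; decide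
    · convert key 0 (by decide) (-1) (by decide) using 7; decide
    · convert key 1 (by decide) 1 (by decide) using 7; decide
    · convert key 1 (by decide) (-1) (by decide) using 7; decide

/-- The first `n + 1` positions of the walk. -/
def hist {Ω : Type*} (S : ℕ → Ω → Site) (n : ℕ) (ω : Ω) : Fin (n + 1) → Site := fun k => S k ω

theorem hist_eq_iff {Ω : Type*} {S : ℕ → Ω → Site} {n : ℕ} {ω ω₀ : Ω} :
    hist S n ω = hist S n ω₀ ↔ ∀ k ≤ n, S k ω = S k ω₀ := by
  constructor
  · intro h k hk
    exact congrFun h ⟨k, by omega⟩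
  · intro h
    ext1 k
    exact h k (by omega)

section Fibers

variable {Ω : Type*} [MeasurableSpace Ω] {P : Measure Ω}

/-- A property which holds almost surely on each fiber of a map with countable range
holds almost surely. -/
theorem ae_of_fibers {ι : Type*} [Countable ι] (f : Ω → ι) {Q : Ω → Prop}
    (h : ∀ ω₀, P {ω | f ω = f ω₀ ∧ ¬ Q ω} = 0) : ∀ᵐ ω ∂P, Q ω := by
  rw [ae_iff]
  have : {ω | ¬ Q ω} ⊆ ⋃ i : ι, {ω | f ω = i ∧ ¬ Q ω} := by
    intro ω hω
    exact Set.mem_iUnion.2 ⟨f ω, rfl, hω⟩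
  refine measure_mono_null this (measure_iUnion_null fun i => ?_)
  by_cases hi : ∃ ω₀, f ω₀ = i
  · obtain ⟨ω₀, rfl⟩ := hi
    exact h ω₀
  · convert measure_empty (μ := P)
    ext ω
    simp only [Set.mem_ofPred_eq, Set.mem_empty_iff_false, iff_false, not_and]
    exact fun hf => absurd ⟨ω, hf⟩ hi

theorem integral_nonpos_of_fibers {ι : Type*} [Countable ι] (f : Ω → ι)
    (hf : ∀ ω₀, MeasurableSet {ω | f ω = f ω₀}) {Y : Ω → ℝ} (hY : Integrable Y P)
    (h : ∀ ω₀, ∫ ω in {ω | f ω = f ω₀}, Y ω ∂P ≤ 0) : ∫ ω, Y ω ∂P ≤ 0 := by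
  have hm : ∀ i : ι, MeasurableSet {ω | f ω = i} := by
    intro i
    by_cases hi : ∃ ω₀, f ω₀ = i
    · obtain ⟨ω₀, rfl⟩ := hi
      exact hf ω₀
    · convert MeasurableSet.empty (α := Ω)
      ext ω
      simp only [Set.mem_ofPred_eq, Set.mem_empty_iff_false, iff_false]
      exact fun hf => absurd ⟨ω, hf⟩ hi
  have hU : (⋃ i : ι, {ω | f ω = i}) = Set.univ := by
    ext ω
    simp
  have hd : Pairwise (Function.onFun Disjoint fun i : ι => {ω | f ω = i}) := by
    intro i j hij
    rw [Function.onFun, Set.disjoint_left]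
    rintro ω rfl h2
    exact hij h2
  have := integral_iUnion hm hd (hY.integrableOn (s := _))
  rw [hU, Measure.restrict_univ] at this
  rw [this]
  refine tsum_nonpos fun i => ?_
  by_cases hi : ∃ ω₀, f ω₀ = i
  · obtain ⟨ω₀, rfl⟩ := hi
    exact h ω₀
  · have : {ω | f ω = i} = ∅ := by
      ext ω
      simp only [Set.mem_ofPred_eq, Set.mem_empty_iff_false, iff_false]
      exact fun hf => absurd ⟨ω, hf⟩ hi
    simp [this]

theorem integral_eq_zero_of_fibers {ι : Type*} [Countable ι] (f : Ω → ι)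
    (hf : ∀ ω₀, MeasurableSet {ω | f ω = f ω₀}) {Y : Ω → ℝ} (hY : Integrable Y P)
    (h : ∀ ω₀, ∫ ω in {ω | f ω = f ω₀}, Y ω ∂P = 0) : ∫ ω, Y ω ∂P = 0 := by
  refine le_antisymm (integral_nonpos_of_fibers f hf hY fun ω₀ => (h ω₀).le) ?_
  have := integral_nonpos_of_fibers f hf hY.neg fun ω₀ => by
    simp only [Pi.neg_apply]
    rw [integral_neg, h ω₀, neg_zero]
  simp only [Pi.neg_apply] at this
  rw [integral_neg] at this
  linarith

end Fibers

section Walk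

variable {Ω : Type*} [MeasurableSpace Ω] {P : Measure Ω} {S : ℕ → Ω → Site}

theorem measurableSet_hist (hm : ∀ n, Measurable (S n)) (n : ℕ) (h : ℕ → Site) :
    MeasurableSet {ω | ∀ k ≤ n, S k ω = h k} := by
  have : {ω | ∀ k ≤ n, S k ω = h k} = ⋂ k ∈ Set.Iic n, S k ⁻¹' {h k} := by
    ext ω
    simp
  rw [this]
  exact MeasurableSet.biInter (Set.to_countable _) fun k _ => hm k (measurableSet_singleton _)

theorem measurable_of_congr {β : Type*} [MeasurableSpace β] (hm : ∀ n, Measurable (S n)) {n : ℕ}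
    {Φ : (ℕ → Site) → β} (hΦ : ∀ p q, (∀ k ≤ n, p k = q k) → Φ p = Φ q) :
    Measurable fun ω => Φ fun k => S k ω := by
  have h1 : Measurable (hist S n) := measurable_pi_lambda _ fun k => hm k
  have h2 : (fun ω => Φ fun k => S k ω)
      = (fun h : Fin (n + 1) → Site => Φ fun k => h ⟨min k n, by omega⟩) ∘ hist S n := by
    ext1 ω
    refine hΦ _ _ fun k hk => ?_
    simp [hist, hk]
  rw [h2]
  exact (measurable_of_countable _).comp h1

theorem measurableSet_step (hm : ∀ n, Measurable (S n)) (n : ℕ) (h : ℕ → Site) (x : Site) :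
    MeasurableSet {ω | (∀ k ≤ n, S k ω = h k) ∧ S (n + 1) ω = x} :=
  (measurableSet_hist hm n h).inter (hm (n + 1) (measurableSet_singleton x))

theorem ae_step_mem_moves [IsProbabilityMeasure P] (hS : IsBERW 4 2 3 P S) :
    ∀ᵐ ω ∂P, ∀ n, S (n + 1) ω - S n ω ∈ moves (fun k => S k ω) n := by
  rw [ae_all_iff]
  intro n
  refine ae_of_fibers (hist S n) fun ω₀ => ?_
  simp only [hist_eq_iff]
  set h : ℕ → Site := fun k => S k ω₀ with hh
  set A := {ω | ∀ k ≤ n, S k ω = h k} with hA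
  set B := ⋃ e ∈ moves h n, {ω | (∀ k ≤ n, S k ω = h k) ∧ S (n + 1) ω = h n + e} with hB
  have hBm : MeasurableSet B :=
    Finset.measurableSet_biUnion _ fun e _ => measurableSet_step hS.1 n h _
  have hBA : P B = P A := by
    rw [hB, measure_biUnion_finset _ fun e _ => measurableSet_step hS.1 n h _]
    · rw [Finset.sum_congr rfl fun e he => measure_step hS n h he, Finset.sum_const,
        nsmul_eq_mul]
      refine ENNReal.mul_div_cancel ?_ (by simp)
      simpa using (moves_nonempty h n).ne_empty
    · intro e _ e' _ hee
      rw [Function.onFun, Set.disjoint_left]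
      rintro ω ⟨-, h1⟩ ⟨-, h2⟩
      exact hee (add_left_cancel (h1.symm.trans h2))
  have hsub : B ⊆ A := by
    intro ω hω
    simp only [hB, Set.mem_iUnion] at hω
    obtain ⟨e, he, h1, -⟩ := hω
    exact h1
  have hz : P (A \ B) = 0 := by
    rw [measure_sdiff hsub hBm.nullMeasurableSet (measure_ne_top _ _), hBA, tsub_self]
  refine measure_mono_null ?_ hz
  rintro ω ⟨h1, h2⟩
  refine ⟨h1, fun h3 => h2 ?_⟩
  simp only [hB, Set.mem_iUnion] at h3
  obtain ⟨e, he, -, h4⟩ := h3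
  rw [moves_congr (q := h) h1, h4, h1 n le_rfl, add_sub_cancel_left]
  exact he

/-- The one-step drift inequality for functionals of the walk. -/
theorem integral_step_nonpos [IsProbabilityMeasure P] (hS : IsBERW 4 2 3 P S) (n : ℕ)
    {Φ : (ℕ → Site) → ℝ} (hΦ : ∀ p q, (∀ k ≤ n + 1, p k = q k) → Φ p = Φ q)
    {C : ℝ} (hC : ∀ᵐ ω ∂P, |Φ fun k => S k ω| ≤ C)
    (hd : ∀ p : ℕ → Site,
      ∑ e ∈ moves p n, Φ (Function.update p (n + 1) (p n + e)) ≤ 0) :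
    ∫ ω, Φ (fun k => S k ω) ∂P ≤ 0 := by
  have hint : Integrable (fun ω => Φ fun k => S k ω) P :=
    Integrable.of_bound (measurable_of_congr hS.1 hΦ).aestronglyMeasurable C hC
  refine integral_nonpos_of_fibers (hist S n) (fun ω₀ => ?_) hint fun ω₀ => ?_
  · simp only [hist_eq_iff]
    exact measurableSet_hist hS.1 n _
  simp only [hist_eq_iff]
  set h : ℕ → Site := fun k => S k ω₀ with hh
  set A := {ω | ∀ k ≤ n, S k ω = h k} with hA
  have hAB : A =ᵐ[P] ⋃ e ∈ moves h n,
      {ω | (∀ k ≤ n, S k ω = h k) ∧ S (n + 1) ω = h n + e} := by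
    filter_upwards [ae_step_mem_moves hS] with ω hω
    refine propext ⟨fun h1 => ?_, fun h1 => ?_⟩
    · refine Set.mem_iUnion₂.2 ⟨S (n + 1) ω - S n ω, ?_, h1, ?_⟩
      · rw [← moves_congr (p := fun k => S k ω) h1]
        exact hω n
      · rw [← h1 n le_rfl]
        simp
    · obtain ⟨e, he, h2, -⟩ := Set.mem_iUnion₂.1 h1
      exact h2
  rw [setIntegral_congr_set hAB, integral_biUnion_finset _
    (fun e _ => measurableSet_step hS.1 n h _) _ fun e _ => hint.integrableOn]
  · have hw : ∀ e ∈ moves h n,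
        ∫ ω in {ω | (∀ k ≤ n, S k ω = h k) ∧ S (n + 1) ω = h n + e}, Φ (fun k => S k ω) ∂P
          = (P.real A / (moves h n).card) * Φ (Function.update h (n + 1) (h n + e)) := by
      intro e he
      rw [setIntegral_congr_fun (g := fun _ => Φ (Function.update h (n + 1) (h n + e)))
        (measurableSet_step hS.1 n h _), setIntegral_const, smul_eq_mul, measureReal_def,
        measure_step hS n h he, ENNReal.toReal_div, measureReal_def,
        ENNReal.toReal_natCast]
      rintro ω ⟨h1, h2⟩
      refine hΦ _ _ fun k hk => ?_
      rcases Nat.lt_or_ge n k with hk' | hk'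
      · obtain rfl : k = n + 1 := by omega
        simp [h2]
      · rw [Function.update_of_ne (by omega)]
        exact h1 k hk'
    rw [Finset.sum_congr rfl hw, ← Finset.mul_sum]
    exact mul_nonpos_of_nonneg_of_nonpos (by positivity) (hd h)
  · intro e _ e' _ hee
    rw [Function.onFun, Set.disjoint_left]
    rintro ω ⟨-, h1⟩ ⟨-, h2⟩
    exact hee (add_left_cancel (h1.symm.trans h2))

end Walk

section Clock

theorem cnt_mono (p : ℕ → Site) : Monotone (cnt p) :=
  monotone_nat_of_le_succ fun n => by simp [cnt]

theorem cnt_succ_le (p : ℕ → Site) (n : ℕ) : cnt p (n + 1) ≤ cnt p n + 1 := by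
  simp only [cnt]
  split_ifs <;> omega

theorem cnt_succ_of_ne {p : ℕ → Site} {n : ℕ} (h : zw (p (n + 1)) ≠ zw (p n)) :
    cnt p (n + 1) = cnt p n + 1 := by
  simp only [cnt, if_neg h]

theorem cnt_succ_of_eq {p : ℕ → Site} {n : ℕ} (h : zw (p (n + 1)) = zw (p n)) :
    cnt p (n + 1) = cnt p n := by
  simp only [cnt, if_pos h, add_zero]

theorem exists_move_of_cnt_lt {p : ℕ → Site} {a b : ℕ} (h : cnt p a < cnt p b) :
    ∃ j, a ≤ j ∧ j < b ∧ zw (p (j + 1)) ≠ zw (p j) := by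
  induction b with
  | zero => simp [cnt] at h
  | succ b ih =>
    by_cases hb : zw (p (b + 1)) = zw (p b)
    · simp only [cnt, hb, if_true, add_zero] at h
      obtain ⟨j, h1, h2, h3⟩ := ih h
      exact ⟨j, h1, by omega, h3⟩
    · refine ⟨b, ?_, by omega, hb⟩
      by_contra! hab
      exact absurd (cnt_mono p (show b + 1 ≤ a by omega)) (by omega)

theorem zw_eq_of_cnt_eq {p : ℕ → Site} {a b : ℕ} (hab : a ≤ b) (h : cnt p a = cnt p b) :
    zw (p a) = zw (p b) := by
  induction b, hab using Nat.le_induction with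
  | base => rfl
  | succ b hab ih =>
    have h1 := cnt_mono p hab
    have h2 : cnt p b ≤ cnt p (b + 1) := cnt_mono p (Nat.le_succ b)
    rw [ih (by omega)]
    by_contra hne
    have := cnt_succ_of_ne fun h' => hne (Eq.symm h')
    omega

variable {Ω : Type*} {S : ℕ → Ω → Site} {ω : Ω}

theorem not_zw_eq_iff (S : ℕ → Ω → Site) (ω : Ω) (a b : ℕ) :
    ¬(S a ω 2 = S b ω 2 ∧ S a ω 3 = S b ω 3) ↔ zw (S a ω) ≠ zw (S b ω) := by
  simp [zw]

theorem cnt_tau_of_iff {k : ℕ} (h : ∀ n, tau S k ω ≤ n ↔ k ≤ cnt (fun k => S k ω) n) :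
    cnt (fun k => S k ω) (tau S k ω) = k := by
  refine le_antisymm ?_ ((h _).1 le_rfl)
  by_contra! hlt
  rcases Nat.eq_zero_or_pos (tau S k ω) with h0 | h0
  · simp [h0, cnt] at hlt
  · have h1 : ¬ k ≤ cnt (fun k => S k ω) (tau S k ω - 1) := by
      rw [← h]
      omega
    have h2 := cnt_succ_le (fun k => S k ω) (tau S k ω - 1)
    rw [Nat.sub_add_cancel h0] at h2
    omega

theorem tau_le_iff (hu : ∀ m, ∃ n, m ≤ cnt (fun k => S k ω) n) (k : ℕ) :
    ∀ n, tau S k ω ≤ n ↔ k ≤ cnt (fun k => S k ω) n := by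
  set p : ℕ → Site := fun k => S k ω with hp
  induction k with
  | zero => simp [tau]
  | succ k ih =>
    have hk : cnt p (tau S k ω) = k := cnt_tau_of_iff ih
    have hmem : ∀ n, k + 1 ≤ cnt p n → ∃ j < n, (j + 1) ∈ {n : ℕ | tau S k ω < n ∧
        ¬(S n ω 2 = S (n - 1) ω 2 ∧ S n ω 3 = S (n - 1) ω 3)} := by
      intro n hn
      obtain ⟨j, h1, h2, h3⟩ := exists_move_of_cnt_lt (p := p) (a := tau S k ω) (b := n) (by omega)
      refine ⟨j, h2, by omega, ?_⟩
      rw [not_zw_eq_iff]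
      exact h3
    intro n
    constructor
    · intro hn
      obtain ⟨n', hn'⟩ := hu (k + 1)
      obtain ⟨j, -, hj⟩ := hmem n' hn'
      have hs := Nat.sInf_mem (Set.nonempty_of_mem hj)
      change tau S k ω < tau S (k + 1) ω ∧
        ¬(S (tau S (k + 1) ω) ω 2 = S (tau S (k + 1) ω - 1) ω 2 ∧
          S (tau S (k + 1) ω) ω 3 = S (tau S (k + 1) ω - 1) ω 3) at hs
      rw [not_zw_eq_iff] at hs
      obtain ⟨h1, h2⟩ := hs
      refine le_trans ?_ (cnt_mono p hn)
      obtain ⟨l, hl⟩ : ∃ l, tau S (k + 1) ω = l + 1 := ⟨tau S (k + 1) ω - 1, by omega⟩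
      rw [hl] at h1 ⊢
      have h3 := cnt_mono p (show tau S k ω ≤ l by omega)
      have h4 : cnt p (l + 1) = cnt p l + 1 := by
        rw [hl] at h2
        exact cnt_succ_of_ne h2
      omega
    · intro hn
      obtain ⟨j, hj, hj'⟩ := hmem n hn
      exact (Nat.sInf_le hj').trans hj

theorem cnt_tau (hu : ∀ m, ∃ n, m ≤ cnt (fun k => S k ω) n) (k : ℕ) :
    cnt (fun k => S k ω) (tau S k ω) = k :=
  cnt_tau_of_iff (tau_le_iff hu k)

theorem Uproc_eq (hu : ∀ m, ∃ n, m ≤ cnt (fun k => S k ω) n) {k n : ℕ}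
    (h : cnt (fun k => S k ω) n = k) : Uproc S k ω = zw (S n ω) := by
  have h1 : tau S k ω ≤ n := (tau_le_iff hu k n).2 h.ge
  exact zw_eq_of_cnt_eq (p := fun k => S k ω) h1 ((cnt_tau hu k).trans h.symm)

theorem tau_set_nonempty (hu : ∀ m, ∃ n, m ≤ cnt (fun k => S k ω) n) (k : ℕ) :
    {n : ℕ | tau S k ω < n ∧
      ¬(S n ω 2 = S (n - 1) ω 2 ∧ S n ω 3 = S (n - 1) ω 3)}.Nonempty := by
  obtain ⟨n, hn⟩ := hu (k + 1)
  obtain ⟨j, h1, -, h3⟩ := exists_move_of_cnt_lt (p := fun k => S k ω) (a := tau S k ω) (b := n)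
    (by rw [cnt_tau hu]; omega)
  refine ⟨j + 1, by omega, ?_⟩
  rw [not_zw_eq_iff]
  exact h3

/-- The trajectory moves at each time by an allowed step, and its last two coordinates
move infinitely often. -/
structure Good (p : ℕ → Site) : Prop where
  step : ∀ n, p (n + 1) - p n ∈ moves p n
  unbounded : ∀ m, ∃ n, m ≤ cnt p n

theorem mem_moves_cases {p : ℕ → Site} {n : ℕ} {e : Site} (h : e ∈ moves p n) :
    e ∈ newMoves ∨ e ∈ oldMoves := by
  unfold moves at h
  split_ifs at h
  · exact Or.inr h
  · exact Or.inl h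

theorem abs_first_le_one {p : ℕ → Site} {n : ℕ} {e : Site} (h : e ∈ moves p n) :
    |(e 0 : ℝ)| ≤ 1 := by
  have : |e 0| ≤ 1 := by
    rcases mem_moves_cases h with h | h
    · clear * - h
      revert e
      decide
    · clear * - h
      revert e
      decide
  exact_mod_cast this

theorem zw_move {p : ℕ → Site} {n : ℕ} {e : Site} (h : e ∈ moves p n) (h0 : zw e ≠ 0) :
    zw e ∈ ({(1, 0), (-1, 0), (0, 1), (0, -1)} : Finset (ℤ × ℤ)) := by
  have hnew : ∀ e ∈ newMoves, zw e ≠ 0 →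
      zw e ∈ ({(1, 0), (-1, 0), (0, 1), (0, -1)} : Finset (ℤ × ℤ)) := by decide
  have hold : ∀ e ∈ oldMoves, zw e ≠ 0 →
      zw e ∈ ({(1, 0), (-1, 0), (0, 1), (0, -1)} : Finset (ℤ × ℤ)) := by decide
  exact (mem_moves_cases h).elim (fun h => hnew e h h0) fun h => hold e h h0

theorem zw_sub (x y : Site) : zw (x - y) = zw x - zw y := rfl

theorem Uproc_sub_mem (hg : Good fun k => S k ω) (k : ℕ) :
    Uproc S (k + 1) ω - Uproc S k ω
      ∈ ({(1, 0), (-1, 0), (0, 1), (0, -1)} : Finset (ℤ × ℤ)) := by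
  have hc := cnt_tau hg.unbounded (k + 1)
  obtain ⟨l, hl⟩ : ∃ l, tau S (k + 1) ω = l + 1 := by
    refine ⟨tau S (k + 1) ω - 1, ?_⟩
    have : tau S (k + 1) ω ≠ 0 := by
      intro h
      simp [h, cnt] at hc
    omega
  have h1 : ¬ k + 1 ≤ cnt (fun k => S k ω) l := by
    rw [← tau_le_iff hg.unbounded, hl]
    omega
  have h2 := cnt_succ_le (fun k => S k ω) l
  rw [hl] at hc
  rw [Uproc_eq hg.unbounded hc, Uproc_eq (k := k) (n := l) hg.unbounded (by omega), ← zw_sub]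
  refine zw_move (hg.step l) ?_
  rw [zw_sub, sub_ne_zero]
  intro h
  rw [cnt_succ_of_eq h] at hc
  omega

end Clock

section Drift

theorem update_succ_of_le {p : ℕ → Site} {n k : ℕ} (x : Site) (h : k ≤ n) :
    Function.update p (n + 1) x k = p k :=
  Function.update_of_ne (by omega) _ _

theorem zw_add_eq_iff (x e : Site) : zw (x + e) = zw x ↔ zw e = 0 := by
  simp [zw]

theorem cnt_update (p : ℕ → Site) (n : ℕ) (e : Site) :
    cnt (Function.update p (n + 1) (p n + e)) (n + 1)
      = cnt p n + if zw e = 0 then 0 else 1 := by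
  simp only [cnt, Function.update_self, update_succ_of_le _ le_rfl, zw_add_eq_iff]
  rw [cnt_congr fun k hk => update_succ_of_le _ hk]

open Classical in
/-- A bound for the waiting time until the walk is at an old site. -/
noncomputable def wait (p : ℕ → Site) (n : ℕ) : ℝ :=
  if IsOld p n then 0 else if ∃ k, k + 1 = n ∧ p k - p n ∈ newMoves then 4 else 5

open Classical in
/-- A Lyapunov function for the number of moves of the last two coordinates to reach `m`. -/
noncomputable def lyap (m : ℕ) (p : ℕ → Site) (n : ℕ) : ℝ :=
  if cnt p n < m then 9 * ((m : ℝ) - cnt p n) + wait p n else 0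

theorem wait_nonneg (p : ℕ → Site) (n : ℕ) : 0 ≤ wait p n := by
  unfold wait
  split_ifs <;> norm_num

theorem wait_le (p : ℕ → Site) (n : ℕ) : wait p n ≤ 5 := by
  unfold wait
  split_ifs <;> norm_num

theorem wait_congr {p q : ℕ → Site} {n : ℕ} (h : ∀ k ≤ n, p k = q k) :
    wait p n = wait q n := by
  have h2 : (∃ k, k + 1 = n ∧ p k - p n ∈ newMoves) ↔ ∃ k, k + 1 = n ∧ q k - q n ∈ newMoves := by
    refine exists_congr fun k => and_congr_right fun hk => ?_
    rw [h k (by omega), h n le_rfl]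
  classical
  exact if_congr (isOld_congr h) rfl (if_congr h2 rfl rfl)

theorem lyap_congr {m : ℕ} {p q : ℕ → Site} {n : ℕ} (h : ∀ k ≤ n, p k = q k) :
    lyap m p n = lyap m q n := by
  unfold lyap
  rw [cnt_congr h, wait_congr h]

theorem lyap_nonneg (m : ℕ) (p : ℕ → Site) (n : ℕ) : 0 ≤ lyap m p n := by
  unfold lyap
  split_ifs with h
  · have h1 : (cnt p n : ℝ) ≤ m := by exact_mod_cast h.le
    have := wait_nonneg p n
    linarith
  · exact le_rfl

theorem lyap_le (m : ℕ) (p : ℕ → Site) (n : ℕ) : lyap m p n ≤ 9 * m + 5 := by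
  unfold lyap
  split_ifs with h
  · have h1 : (0 : ℝ) ≤ cnt p n := by positivity
    have := wait_le p n
    linarith
  · positivity

theorem wait_update_le {p : ℕ → Site} {n : ℕ} {e : Site} (he : e ∈ newMoves) :
    wait (Function.update p (n + 1) (p n + e)) (n + 1) ≤ 4 := by
  have h : ∃ k, k + 1 = n + 1 ∧ Function.update p (n + 1) (p n + e) k
      - Function.update p (n + 1) (p n + e) (n + 1) ∈ newMoves := by
    refine ⟨n, rfl, ?_⟩
    rw [update_succ_of_le _ le_rfl, Function.update_self, sub_add_cancel_left]
    revert e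
    decide
  unfold wait
  rw [if_pos h]
  split_ifs <;> norm_num

theorem lyap_drift (m : ℕ) (p : ℕ → Site) (n : ℕ) :
    ∑ e ∈ moves p n, (lyap m (Function.update p (n + 1) (p n + e)) (n + 1)
      - lyap m p n + if cnt p n < m then 1 else 0) ≤ 0 := by
  by_cases hm : cnt p n < m
  swap
  · refine Finset.sum_nonpos fun e _ => ?_
    unfold lyap
    rw [if_neg hm, if_neg hm, if_neg]
    · simp
    · rw [cnt_update]
      omega
  have hm' : (cnt p n : ℝ) + 1 ≤ m := by exact_mod_cast hm
  simp only [if_pos hm]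
  have hl : lyap m p n = 9 * ((m : ℝ) - cnt p n) + wait p n := if_pos hm
  have hstay : ∀ e, zw e = 0 → lyap m (Function.update p (n + 1) (p n + e)) (n + 1)
      = 9 * ((m : ℝ) - cnt p n) + wait (Function.update p (n + 1) (p n + e)) (n + 1) := by
    intro e he
    unfold lyap
    rw [cnt_update, if_pos he, add_zero, if_pos hm]
  by_cases ho : IsOld p n
  · have hw : wait p n = 0 := if_pos ho
    rw [show moves p n = oldMoves from if_pos ho]
    calc _ ≤ ∑ e ∈ oldMoves, (if zw e = 0 then (6 : ℝ) else -3) := by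
            refine Finset.sum_le_sum fun e _ => ?_
            split_ifs with he
            · rw [hstay e he, hl, hw]
              linarith [wait_le (Function.update p (n + 1) (p n + e)) (n + 1)]
            · rw [hl, hw]
              unfold lyap
              rw [cnt_update, if_neg he]
              split_ifs
              · push_cast
                linarith [wait_le (Function.update p (n + 1) (p n + e)) (n + 1)]
              · linarith
      _ ≤ 0 := by
            rw [sum_oldMoves]
            simp [zw]
            norm_num
  · rw [show moves p n = newMoves from if_neg ho]
    have hz : ∀ e ∈ newMoves, zw e = 0 := by decide
    by_cases hp : ∃ k, k + 1 = n ∧ p k - p n ∈ newMoves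
    · have hw : wait p n = 4 := by
        unfold wait
        rw [if_neg ho, if_pos hp]
      obtain ⟨k, hk, hk'⟩ := hp
      calc _ ≤ ∑ e ∈ newMoves, ((1 : ℝ) - if p k - p n = e then 4 else 0) := by
              refine Finset.sum_le_sum fun e he => ?_
              rw [hstay e (hz e he), hl, hw]
              split_ifs with hek
              · have : IsOld (Function.update p (n + 1) (p n + e)) (n + 1) := by
                  refine ⟨k, by omega, ?_⟩
                  rw [Function.update_self, update_succ_of_le _ (by omega), ← hek]
                  abel
                rw [show wait (Function.update p (n + 1) (p n + e)) (n + 1) = 0 from if_pos this]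
                linarith
              · linarith [wait_update_le (p := p) (n := n) he]
        _ ≤ 0 := by
              rw [Finset.sum_sub_distrib, Finset.sum_ite_eq, if_pos hk', Finset.sum_const,
                card_newMoves]
              norm_num
    · have hw : wait p n = 5 := by
        unfold wait
        rw [if_neg ho, if_neg hp]
      refine Finset.sum_nonpos fun e he => ?_
      rw [hstay e (hz e he), hl, hw]
      linarith [wait_update_le (p := p) (n := n) he]

variable {Ω : Type*} [MeasurableSpace Ω] {P : Measure Ω} {S : ℕ → Ω → Site}

theorem measurableSet_cnt_lt (hm : ∀ n, Measurable (S n)) (n m : ℕ) :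
    MeasurableSet {ω | cnt (fun k => S k ω) n < m} :=
  measurable_of_congr (Φ := fun p => cnt p n) hm (fun _ _ => cnt_congr) measurableSet_Iio

theorem sum_cnt_lt_le [IsProbabilityMeasure P] (hS : IsBERW 4 2 3 P S) (m n : ℕ) :
    ∫ ω, lyap m (fun k => S k ω) n ∂P
      + ∑ j ∈ Finset.range n, P.real {ω | cnt (fun k => S k ω) j < m} ≤ 9 * m + 5 := by
  have hint : ∀ n, Integrable (fun ω => lyap m (fun k => S k ω) n) P := fun n =>
    Integrable.of_bound (measurable_of_congr (Φ := fun p => lyap m p n) hS.1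
      (fun _ _ => lyap_congr)).aestronglyMeasurable (9 * m + 5) (ae_of_all _ fun ω => by
        rw [Real.norm_of_nonneg (lyap_nonneg _ _ _)]
        exact lyap_le _ _ _)
  induction n with
  | zero =>
    rw [Finset.sum_range_zero, add_zero]
    calc _ ≤ ∫ _, (9 * (m : ℝ) + 5) ∂P :=
          integral_mono (hint 0) (integrable_const _) fun ω => lyap_le _ _ _
      _ = _ := by simp
  | succ n ih =>
    have key := integral_step_nonpos hS n
      (Φ := fun p => lyap m p (n + 1) - lyap m p n + if cnt p n < m then 1 else 0)
      (C := 9 * m + 5 + 1) ?_ ?_ ?_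
    · have hi : Integrable ({ω | cnt (fun k => S k ω) n < m}.indicator fun _ => (1 : ℝ)) P :=
        (integrable_const _).indicator (measurableSet_cnt_lt hS.1 n m)
      have : (fun ω => if cnt (fun k => S k ω) n < m then (1 : ℝ) else 0)
          = {ω | cnt (fun k => S k ω) n < m}.indicator fun _ => (1 : ℝ) := by
        ext ω
        simp [Set.indicator_apply]
      have hs : Integrable (fun ω => lyap m (fun k => S k ω) (n + 1)
          - lyap m (fun k => S k ω) n) P := (hint (n + 1)).sub (hint n)
      rw [integral_add hs (this ▸ hi),
        integral_sub (hint (n + 1)) (hint n), this,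
        integral_indicator_const _ (measurableSet_cnt_lt hS.1 n m), smul_eq_mul, mul_one] at key
      rw [Finset.sum_range_succ]
      linarith
    · intro p q hpq
      have hpq' : ∀ k ≤ n, p k = q k := fun k hk => hpq k (by omega)
      simp only [lyap_congr hpq, lyap_congr hpq', cnt_congr hpq']
    · refine ae_of_all _ fun ω => ?_
      have h1 := lyap_nonneg m (fun k => S k ω) (n + 1)
      have h2 := lyap_nonneg m (fun k => S k ω) n
      have h3 := lyap_le m (fun k => S k ω) (n + 1)
      have h4 := lyap_le m (fun k => S k ω) n
      rw [abs_le]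
      constructor <;> split_ifs <;> linarith
    · intro p
      have h := lyap_drift m p n
      convert h using 4 with e he
      · rw [lyap_congr fun k hk => update_succ_of_le _ hk]
      · rw [cnt_congr fun k hk => update_succ_of_le _ hk]

theorem tsum_cnt_lt_ne_top [IsProbabilityMeasure P] (hS : IsBERW 4 2 3 P S) (m : ℕ) :
    ∑' j, P {ω | cnt (fun k => S k ω) j < m} ≠ ⊤ := by
  refine ne_top_of_le_ne_top (b := ENNReal.ofReal (9 * m + 5)) ENNReal.ofReal_ne_top ?_
  refine ENNReal.tsum_le_of_sum_range_le fun n => ?_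
  have h := sum_cnt_lt_le hS m n
  have h0 : 0 ≤ ∫ ω, lyap m (fun k => S k ω) n ∂P :=
    integral_nonneg fun ω => lyap_nonneg _ _ _
  rw [Finset.sum_congr rfl fun j _ => (ofReal_measureReal (measure_ne_top P _)).symm,
    ← ENNReal.ofReal_sum_of_nonneg fun _ _ => measureReal_nonneg]
  exact ENNReal.ofReal_le_ofReal (by linarith)

theorem ae_good [IsProbabilityMeasure P] (hS : IsBERW 4 2 3 P S) :
    ∀ᵐ ω ∂P, Good fun k => S k ω := by
  have h : ∀ᵐ ω ∂P, ∀ m, ∃ n, m ≤ cnt (fun k => S k ω) n := by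
    rw [ae_all_iff]
    intro m
    filter_upwards [ae_eventually_notMem (tsum_cnt_lt_ne_top hS m)] with ω hω
    obtain ⟨n, hn⟩ := hω.exists
    exact ⟨n, not_lt.1 hn⟩
  filter_upwards [h, ae_step_mem_moves hS] with ω h1 h2
  exact ⟨h2, h1⟩

theorem measurable_sInf_nat {Q : ℕ → Ω → Prop} (h : ∀ n, MeasurableSet {ω | Q n ω}) :
    Measurable fun ω => sInf {n | Q n ω} := by
  refine measurable_to_countable' fun c => ?_
  have : (fun ω => sInf {n | Q n ω}) ⁻¹' {c}
      = ({ω | Q c ω} ∩ ⋂ j ∈ Set.Iio c, {ω | Q j ω}ᶜ)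
        ∪ ({_ω | c = 0} ∩ ⋂ n, {ω | Q n ω}ᶜ) := by
    ext ω
    simp only [Set.mem_preimage, Set.mem_singleton_iff, Set.mem_union, Set.mem_inter_iff,
      Set.mem_iInter, Set.mem_compl_iff, Set.mem_ofPred_eq, Set.mem_Iio]
    constructor
    · rintro rfl
      rcases Set.eq_empty_or_nonempty {n | Q n ω} with he | hne
      · right
        rw [he, Nat.sInf_empty]
        exact ⟨rfl, fun n hn => (he ▸ hn : n ∈ (∅ : Set ℕ))⟩
      · left
        exact ⟨Nat.sInf_mem hne, fun j hj => Nat.notMem_of_lt_sInf hj⟩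
    · rintro (⟨h1, h2⟩ | ⟨rfl, h2⟩)
      · refine le_antisymm (Nat.sInf_le h1) ?_
        by_contra! hlt
        exact h2 _ hlt (Nat.sInf_mem (show {n | Q n ω}.Nonempty from ⟨c, h1⟩))
      · rw [Nat.sInf_eq_zero]
        right
        ext n
        simpa using h2 n
  rw [this]
  exact ((h c).inter (MeasurableSet.biInter (Set.to_countable _) fun j _ => (h j).compl)).union
    ((MeasurableSet.const _).inter (MeasurableSet.iInter fun n => (h n).compl))

theorem measurable_tau (hm : ∀ n, Measurable (S n)) (k : ℕ) : Measurable (tau S k) := by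
  induction k with
  | zero => exact measurable_const
  | succ k ih =>
    refine measurable_sInf_nat fun n => ?_
    have hc : ∀ i : Fin 4, MeasurableSet {ω | S n ω i = S (n - 1) ω i} := fun i =>
      measurableSet_eq_fun ((measurable_pi_apply i).comp (hm n))
        ((measurable_pi_apply i).comp (hm (n - 1)))
    exact (ih measurableSet_Iio).inter ((hc 2).inter (hc 3)).compl

theorem integrable_tau [IsProbabilityMeasure P] (hS : IsBERW 4 2 3 P S) (m : ℕ) :
    Integrable (fun ω => (tau S m ω : ℝ)) P := by
  refine ⟨(measurable_from_nat.comp (measurable_tau hS.1 m)).aestronglyMeasurable, ?_⟩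
  refine lt_of_le_of_lt ?_ (tsum_cnt_lt_ne_top hS m).lt_top
  calc ∫⁻ ω, ‖(tau S m ω : ℝ)‖ₑ ∂P
      ≤ ∫⁻ ω, ∑' j, {ω | cnt (fun k => S k ω) j < m}.indicator 1 ω ∂P := by
        refine lintegral_mono_ae ?_
        filter_upwards [ae_good hS] with ω hω
        calc ‖(tau S m ω : ℝ)‖ₑ = ∑ j ∈ Finset.range (tau S m ω), 1 := by
              simp
          _ = ∑ j ∈ Finset.range (tau S m ω),
                {ω | cnt (fun k => S k ω) j < m}.indicator 1 ω := by
              refine Finset.sum_congr rfl fun j hj => ?_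
              rw [Set.indicator_of_mem, Pi.one_apply]
              have := tau_le_iff hω.unbounded m j
              rw [Finset.mem_range] at hj
              change cnt (fun k => S k ω) j < m
              omega
          _ ≤ _ := ENNReal.sum_le_tsum _
    _ = ∑' j, P {ω | cnt (fun k => S k ω) j < m} := by
        rw [lintegral_tsum]
        · simp only [lintegral_indicator_one (measurableSet_cnt_lt hS.1 _ m)]
        · exact fun j =>
            (measurable_one.indicator (measurableSet_cnt_lt hS.1 j m)).aemeasurable

end Drift

section Martingale

/-- The `m`-th excursion is under way at time `j`, and it started at time `t` with the history
prescribed by `q`. -/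
def Running (m t : ℕ) (q p : ℕ → Site) (j : ℕ) : Prop :=
  cnt p j = m ∧ t ≤ j ∧ (∀ k < t, cnt p k < m) ∧ m ≤ cnt p t ∧ ∀ k ≤ t, p k = q k

open Classical in
/-- The displacement of the first coordinate up to time `n` during the `m`-th excursion. -/
noncomputable def gain (m t : ℕ) (q p : ℕ → Site) (n : ℕ) : ℝ :=
  ∑ j ∈ Finset.range n, if Running m t q p j then (p (j + 1) 0 : ℝ) - p j 0 else 0

/-- The density at time `n` of the walk conditioned to have its first `N` moves of the last
two coordinates given by `d`. -/
noncomputable def weight (N : ℕ) (d : ℕ → ℤ × ℤ) (p : ℕ → Site) : ℕ → ℝ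
  | 0 => 1
  | n + 1 => weight N d p n *
      if cnt p n < N ∧ zw (p (n + 1)) ≠ zw (p n) then
        (if zw (p (n + 1)) - zw (p n) = d (cnt p n) then 4 else 0) else 1

variable {m t N : ℕ} {q : ℕ → Site} {d : ℕ → ℤ × ℤ}

theorem running_congr {p p' : ℕ → Site} {j : ℕ} (h : ∀ k ≤ j, p k = p' k) :
    Running m t q p j ↔ Running m t q p' j := by
  unfold Running
  rw [cnt_congr h]
  refine and_congr_right fun _ => and_congr_right fun htj => ?_
  rw [cnt_congr (n := t) fun k hk => h k (hk.trans htj)]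
  refine and_congr (forall₂_congr fun k hk => ?_)
    (and_congr_right fun _ => forall₂_congr fun k hk => ?_)
  · rw [cnt_congr (n := k) fun i hi => h i (by omega)]
  · rw [h k (by omega)]

theorem gain_congr {p p' : ℕ → Site} {n : ℕ} (h : ∀ k ≤ n, p k = p' k) :
    gain m t q p n = gain m t q p' n := by
  classical
  refine Finset.sum_congr rfl fun j hj => ?_
  rw [Finset.mem_range] at hj
  rw [h (j + 1) (by omega), h j (by omega)]
  exact if_congr (running_congr fun k hk => h k (by omega)) rfl rfl

theorem weight_congr {p p' : ℕ → Site} {n : ℕ} (h : ∀ k ≤ n, p k = p' k) :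
    weight N d p n = weight N d p' n := by
  induction n with
  | zero => rfl
  | succ n ih =>
    have h' : ∀ k ≤ n, p k = p' k := fun k hk => h k (by omega)
    simp only [weight]
    rw [ih h', cnt_congr h', h (n + 1) le_rfl, h n (by omega)]

theorem weight_nonneg (p : ℕ → Site) (n : ℕ) : 0 ≤ weight N d p n := by
  induction n with
  | zero => exact zero_le_one
  | succ n ih =>
    simp only [weight]
    refine mul_nonneg ih ?_
    split_ifs <;> norm_num

theorem weight_le (p : ℕ → Site) (n : ℕ) : weight N d p n ≤ 4 ^ N := by
  suffices h : weight N d p n ≤ 4 ^ min (cnt p n) N from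
    h.trans (pow_le_pow_right₀ (by norm_num) (min_le_right _ _))
  induction n with
  | zero => simp [weight, cnt]
  | succ n ih =>
    have hmono : (4 : ℝ) ^ min (cnt p n) N ≤ 4 ^ min (cnt p (n + 1)) N :=
      pow_le_pow_right₀ (by norm_num) (min_le_min_right _ (cnt_mono p (Nat.le_succ n)))
    simp only [weight]
    split_ifs with h1 h2
    · rw [cnt_succ_of_ne h1.2, show min (cnt p n + 1) N = min (cnt p n) N + 1 by omega, pow_succ]
      linarith
    · rw [mul_zero]
      positivity
    · rw [mul_one]
      exact ih.trans hmono

theorem abs_gain_le {p : ℕ → Site} (hp : ∀ n, p (n + 1) - p n ∈ moves p n) (n : ℕ) :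
    |gain m t q p n| ≤ ((Finset.range n).filter fun j => cnt p j = m).card := by
  classical
  rw [Finset.card_filter]
  push_cast
  refine (Finset.abs_sum_le_sum_abs _ _).trans (Finset.sum_le_sum fun j _ => ?_)
  by_cases hr : Running m t q p j
  · rw [if_pos hr, if_pos hr.1]
    have := abs_first_le_one (hp j)
    rw [Pi.sub_apply] at this
    exact_mod_cast this
  · rw [if_neg hr, abs_zero]
    split_ifs <;> norm_num

theorem abs_gain_mul_weight_le {p : ℕ → Site} (hp : ∀ n, p (n + 1) - p n ∈ moves p n) (n : ℕ)
    {c : ℕ} (hc : ((Finset.range n).filter fun j => cnt p j = m).card ≤ c) :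
    |gain m t q p n * weight N d p n| ≤ c * 4 ^ N := by
  rw [abs_mul, abs_of_nonneg (weight_nonneg (N := N) (d := d) p n)]
  exact mul_le_mul ((abs_gain_le hp n).trans (by exact_mod_cast hc)) (weight_le p n)
    (weight_nonneg p n) (by positivity)

theorem sum_gain_mul_weight (hd : ∀ k < N,
      d k ∈ ({(1, 0), (-1, 0), (0, 1), (0, -1)} : Finset (ℤ × ℤ))) (p : ℕ → Site) (n : ℕ) :
    ∑ e ∈ moves p n,
      (gain m t q (Function.update p (n + 1) (p n + e)) (n + 1)
          * weight N d (Function.update p (n + 1) (p n + e)) (n + 1)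
        - gain m t q p n * weight N d p n) = 0 := by
  classical
  have hg : ∀ e, gain m t q (Function.update p (n + 1) (p n + e)) (n + 1)
      = gain m t q p n + if Running m t q p n then (e 0 : ℝ) else 0 := by
    intro e
    have h := gain_congr (m := m) (t := t) (q := q)
      fun k hk => update_succ_of_le (p := p) (n := n) (p n + e) hk
    unfold gain at h ⊢
    rw [Finset.sum_range_succ, h]
    congr 1
    refine if_congr (running_congr fun k hk => update_succ_of_le _ hk) ?_ rfl
    rw [Function.update_self, update_succ_of_le _ le_rfl, Pi.add_apply]
    push_cast
    ring
  have hw : ∀ e, weight N d (Function.update p (n + 1) (p n + e)) (n + 1)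
      = weight N d p n * if cnt p n < N ∧ zw e ≠ 0 then
        (if zw e = d (cnt p n) then 4 else 0) else 1 := by
    intro e
    simp only [weight]
    rw [weight_congr fun k hk => update_succ_of_le _ hk,
      cnt_congr fun k hk => update_succ_of_le _ hk, Function.update_self,
      update_succ_of_le _ le_rfl, ← zw_sub, add_sub_cancel_left]
    simp only [ne_eq, zw_add_eq_iff]
  simp only [hg, hw]
  by_cases ho : IsOld p n
  · rw [show moves p n = oldMoves from if_pos ho, sum_oldMoves]
    by_cases hN : cnt p n < N
    · have := hd _ hN
      simp only [Finset.mem_insert, Finset.mem_singleton] at this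
      rcases this with h | h | h | h <;> simp [h, hN, zw] <;> ring
    · simp [hN]
  · rw [show moves p n = newMoves from if_neg ho, sum_newMoves]
    simp [zw]
    split_ifs <;> ring

variable {Ω : Type*} {S : ℕ → Ω → Site} {ω : Ω}

theorem running_iff (hu : ∀ m, ∃ n, m ≤ cnt (fun k => S k ω) n) (j : ℕ) :
    Running m t q (fun k => S k ω) j ↔
      (tau S m ω = t ∧ ∀ k ≤ t, S k ω = q k) ∧ tau S m ω ≤ j ∧ ¬ tau S (m + 1) ω ≤ j := by
  unfold Running
  have h1 := tau_le_iff hu m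
  have h2 := tau_le_iff hu (m + 1)
  simp only [← not_le, ← h1]
  rw [h2, h1 j]
  constructor
  · rintro ⟨a, b, c, e, f⟩
    refine ⟨⟨le_antisymm e ?_, f⟩, by omega, by omega⟩
    by_contra! hlt
    exact c _ (not_le.2 hlt) le_rfl
  · rintro ⟨⟨a, f⟩, b, c⟩
    refine ⟨by omega, ?_, fun k hk => by omega, a.le, f⟩
    rw [← a, h1]
    exact b

open Classical in
theorem gain_eq (hu : ∀ m, ∃ n, m ≤ cnt (fun k => S k ω) n) (n : ℕ) :
    gain m t q (fun k => S k ω) n = if tau S m ω = t ∧ ∀ k ≤ t, S k ω = q k then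
      (S (min n (tau S (m + 1) ω)) ω 0 : ℝ) - S (min n (tau S m ω)) ω 0 else 0 := by
  unfold gain
  simp only [running_iff hu]
  by_cases hE : tau S m ω = t ∧ ∀ k ≤ t, S k ω = q k
  · have hle : tau S m ω ≤ tau S (m + 1) ω := by
      rw [tau_le_iff hu, cnt_tau hu]
      omega
    have hs : ∀ j, ((tau S m ω = t ∧ ∀ k ≤ t, S k ω = q k) ∧ tau S m ω ≤ j
        ∧ ¬ tau S (m + 1) ω ≤ j) ↔ tau S m ω ≤ j ∧ ¬ tau S (m + 1) ω ≤ j :=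
      fun j => and_iff_right hE
    rw [if_pos hE]
    simp only [hs]
    induction n with
    | zero => simp
    | succ n ih =>
      rw [Finset.sum_range_succ, ih]
      split_ifs with h
      · rw [min_eq_left (by omega : n ≤ tau S (m + 1) ω),
          min_eq_left (by omega : n + 1 ≤ tau S (m + 1) ω),
          min_eq_right h.1, min_eq_right (by omega : tau S m ω ≤ n + 1)]
        ring
      · rcases Nat.lt_or_ge n (tau S m ω) with h' | h'
        · rw [min_eq_left (by omega : n ≤ tau S (m + 1) ω),
            min_eq_left (by omega : n + 1 ≤ tau S (m + 1) ω),
            min_eq_left (by omega : n ≤ tau S m ω), min_eq_left (by omega : n + 1 ≤ tau S m ω)]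
          ring
        · rw [min_eq_right (by omega : tau S (m + 1) ω ≤ n),
            min_eq_right (by omega : tau S (m + 1) ω ≤ n + 1),
            min_eq_right (by omega : tau S m ω ≤ n), min_eq_right (by omega : tau S m ω ≤ n + 1)]
          ring
  · simp only [hE, false_and, if_false, Finset.sum_const_zero]

open Classical in
theorem weight_eq (hu : ∀ m, ∃ n, m ≤ cnt (fun k => S k ω) n) (n : ℕ) :
    weight N d (fun k => S k ω) n =
      if ∀ k < min (cnt (fun k => S k ω) n) N, Uproc S (k + 1) ω - Uproc S k ω = d k then
        4 ^ min (cnt (fun k => S k ω) n) N else 0 := by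
  induction n with
  | zero => simp [weight, cnt]
  | succ n ih =>
    simp only [weight]
    rw [ih]
    by_cases hz : zw (S (n + 1) ω) = zw (S n ω)
    · rw [cnt_succ_of_eq (p := fun k => S k ω) hz]
      simp [hz]
    · have hc : cnt (fun k => S k ω) (n + 1) = _ := cnt_succ_of_ne (p := fun k => S k ω) hz
      have hU1 := Uproc_eq hu hc
      have hU0 := Uproc_eq hu (n := n) rfl
      rw [hc]
      set c := cnt (fun k => S k ω) n
      by_cases hN : c < N
      · rw [min_eq_left hN.le, min_eq_left (by omega : c + 1 ≤ N)]
        simp only [hN, ne_eq, hz, not_false_eq_true, and_self, if_true, Nat.forall_lt_succ_right]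
        rw [← hU1, ← hU0]
        by_cases h1 : ∀ k < c, Uproc S (k + 1) ω - Uproc S k ω = d k
        · by_cases h2 : Uproc S (c + 1) ω - Uproc S c ω = d c
          · rw [if_pos h1, if_pos h2, if_pos ⟨h1, h2⟩, pow_succ]
          · rw [if_pos h1, if_neg h2, if_neg fun h => h2 h.2, mul_zero]
        · rw [if_neg h1, zero_mul, if_neg fun h => h1 h.1]
      · rw [min_eq_right (by omega : N ≤ c), min_eq_right (by omega : N ≤ c + 1)]
        simp only [hN, false_and, if_false, mul_one]

end Martingale

section Conditioning

variable {Ω : Type*} {S : ℕ → Ω → Site}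

/-- The trajectory up to `τ_m` together with the first `N` values of `U`. -/
noncomputable def record (S : ℕ → Ω → Site) (m N : ℕ) (ω : Ω) :
    ℕ × List Site × List (ℤ × ℤ) :=
  (tau S m ω, (List.range (tau S m ω + 1)).map (fun k => S k ω),
    (List.range (N + 1)).map fun k => Uproc S k ω)

theorem record_eq_iff {m N : ℕ} {ω ω₀ : Ω} : record S m N ω = record S m N ω₀ ↔
    (tau S m ω = tau S m ω₀ ∧ ∀ k ≤ tau S m ω₀, S k ω = S k ω₀) ∧
      ∀ k < N, Uproc S (k + 1) ω - Uproc S k ω = Uproc S (k + 1) ω₀ - Uproc S k ω₀ := by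
  have hmap : ∀ {β : Type} (f g : ℕ → β) (n : ℕ),
      (List.range (n + 1)).map f = (List.range (n + 1)).map g ↔ ∀ k ≤ n, f k = g k := by
    intro β f g n
    rw [List.map_inj_left]
    simp
  simp only [record, Prod.mk.injEq, and_assoc]
  refine and_congr_right fun ht => ?_
  rw [ht, hmap, hmap]
  refine and_congr_right fun hs => ⟨fun h k hk => ?_, fun h k hk => ?_⟩
  · rw [h (k + 1) hk, h k hk.le]
  · induction k with
    | zero =>
      have h0 := hs 0 (Nat.zero_le _)
      simp only [Uproc, tau, h0]
    | succ k ih =>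
      have h1 := h k hk
      rw [ih (by omega)] at h1
      exact sub_left_injective h1

/-- The σ-algebra generated by the trajectory up to `τ_m` and the first `N` values of `U`. -/
noncomputable abbrev recordSigma (S : ℕ → Ω → Site) (m N : ℕ) : MeasurableSpace Ω :=
  MeasurableSpace.comap (record S m N) ⊤

theorem recordSigma_mono (m : ℕ) : Monotone (recordSigma S m) := by
  intro N N' hN
  rintro s ⟨C, -, rfl⟩
  refine ⟨(fun c => (c.1, c.2.1, c.2.2.take (N + 1))) ⁻¹' C, trivial, ?_⟩
  ext ω
  have : (List.map (fun k => Uproc S k ω) (List.range (N' + 1))).take (N + 1)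
      = List.map (fun k => Uproc S k ω) (List.range (N + 1)) := by
    rw [← List.map_take, List.take_range, min_eq_left (by omega)]
  simp only [Set.mem_preimage, record, this]

variable [MeasurableSpace Ω] {P : Measure Ω}

theorem measurable_apply_tau (hm : ∀ n, Measurable (S n)) (k : ℕ) :
    Measurable fun ω => S (tau S k ω) ω :=
  (measurable_from_prod_countable_left (f := fun x : Ω × ℕ => S x.2 x.1) hm).comp
    (measurable_id.prodMk (measurable_tau hm k))

theorem measurable_MartM (hm : ∀ n, Measurable (S n)) (m : ℕ) : Measurable (MartM S m) :=
  (measurable_of_countable fun x : Site => (x 0 : ℝ)).comp (measurable_apply_tau hm m)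

theorem measurable_Uproc (hm : ∀ n, Measurable (S n)) (k : ℕ) : Measurable (Uproc S k) :=
  (measurable_of_countable zw).comp (measurable_apply_tau hm k)

theorem measurableSet_increments (hm : ∀ n, Measurable (S n)) (N : ℕ) (d : ℕ → ℤ × ℤ) :
    MeasurableSet {ω | ∀ k < N, Uproc S (k + 1) ω - Uproc S k ω = d k} := by
  simp only [Set.ofPred_forall]
  exact MeasurableSet.iInter fun k => MeasurableSet.iInter fun _ =>
    ((measurable_Uproc hm (k + 1)).sub (measurable_Uproc hm k)) (measurableSet_singleton _)

theorem integrable_MartM [IsProbabilityMeasure P] (hS : IsBERW 4 2 3 P S) (m : ℕ) :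
    Integrable (MartM S m) P := by
  refine (integrable_tau hS m).mono' (measurable_MartM hS.1 m).aestronglyMeasurable ?_
  filter_upwards [ae_good hS, hS.2.1] with ω hg h0
  have h : ∀ n, |(S n ω 0 : ℝ)| ≤ n := by
    intro n
    induction n with
    | zero => simp [h0]
    | succ n ih =>
      have h1 := abs_first_le_one (hg.step n)
      rw [Pi.sub_apply] at h1
      push_cast at h1 ⊢
      calc |(S (n + 1) ω 0 : ℝ)| = |(S n ω 0 : ℝ) + ((S (n + 1) ω 0 : ℝ) - S n ω 0)| := by
            rw [add_sub_cancel]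
        _ ≤ _ := (abs_add_le _ _).trans (add_le_add ih h1)
  exact h _

theorem integral_gain_mul_weight [IsProbabilityMeasure P] (hS : IsBERW 4 2 3 P S)
    (m t N : ℕ) (q : ℕ → Site) {d : ℕ → ℤ × ℤ} (hd : ∀ k < N,
      d k ∈ ({(1, 0), (-1, 0), (0, 1), (0, -1)} : Finset (ℤ × ℤ))) (n : ℕ) :
    ∫ ω, gain m t q (fun k => S k ω) n * weight N d (fun k => S k ω) n ∂P = 0 := by
  have hbound : ∀ n : ℕ, ∀ᵐ ω ∂P,
      |gain m t q (fun k => S k ω) n * weight N d (fun k => S k ω) n| ≤ n * 4 ^ N := by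
    intro n
    filter_upwards [ae_good hS] with ω hω
    exact abs_gain_mul_weight_le hω.step n ((Finset.card_filter_le _ _).trans (by simp))
  have hcongr : ∀ (n : ℕ) (p p' : ℕ → Site), (∀ k ≤ n, p k = p' k) →
      gain m t q p n * weight N d p n = gain m t q p' n * weight N d p' n :=
    fun n p p' h => by rw [gain_congr h, weight_congr h]
  have hint : ∀ n, Integrable
      (fun ω => gain m t q (fun k => S k ω) n * weight N d (fun k => S k ω) n) P := fun n =>
    Integrable.of_bound (measurable_of_congr
      (Φ := fun p => gain m t q p n * weight N d p n) hS.1 (hcongr n)).aestronglyMeasurable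
      (n * 4 ^ N) (hbound n)
  induction n with
  | zero => simp [gain]
  | succ n ih =>
    set Φ : (ℕ → Site) → ℝ := fun p =>
      gain m t q p (n + 1) * weight N d p (n + 1) - gain m t q p n * weight N d p n with hΦ
    have hΦc : ∀ p p', (∀ k ≤ n + 1, p k = p' k) → Φ p = Φ p' := by
      intro p p' h
      simp only [hΦ, hcongr (n + 1) p p' h, hcongr n p p' fun k hk => h k (by omega)]
    have hΦb : ∀ᵐ ω ∂P, |Φ fun k => S k ω| ≤ ((n + 1 : ℕ) : ℝ) * 4 ^ N + n * 4 ^ N := by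
      filter_upwards [hbound n, hbound (n + 1)] with ω h1 h2
      exact (abs_sub _ _).trans (add_le_add h2 h1)
    have hΦs : ∀ p : ℕ → Site,
        ∑ e ∈ moves p n, Φ (Function.update p (n + 1) (p n + e)) = 0 := by
      intro p
      rw [← sum_gain_mul_weight (m := m) (t := t) (q := q) hd p n]
      refine Finset.sum_congr rfl fun e _ => ?_
      simp only [hΦ]
      rw [hcongr n (Function.update p (n + 1) (p n + e)) p fun k hk => update_succ_of_le _ hk]
    have h1 := integral_step_nonpos hS n hΦc hΦb fun p => (hΦs p).le
    have h2 := integral_step_nonpos hS n (Φ := fun p => -Φ p)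
      (fun p p' h => by rw [hΦc p p' h]) (by simpa only [abs_neg] using hΦb)
      fun p => by rw [Finset.sum_neg_distrib, hΦs, neg_zero]
    rw [integral_neg] at h2
    simp only [hΦ] at h1 h2
    rw [integral_sub (hint (n + 1)) (hint n), ih] at h1 h2
    linarith

theorem setIntegral_atom [IsProbabilityMeasure P] (hS : IsBERW 4 2 3 P S)
    (m t N : ℕ) (q : ℕ → Site) (d : ℕ → ℤ × ℤ) :
    ∫ ω in {ω | (tau S m ω = t ∧ ∀ k ≤ t, S k ω = q k) ∧
        ∀ k < N, Uproc S (k + 1) ω - Uproc S k ω = d k},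
      (MartM S (m + 1) ω - MartM S m ω) ∂P = 0 := by
  classical
  by_cases hd : ∀ k < N, d k ∈ ({(1, 0), (-1, 0), (0, 1), (0, -1)} : Finset (ℤ × ℤ))
  swap
  · push Not at hd
    obtain ⟨k, hk, hdk⟩ := hd
    refine setIntegral_measure_zero _ (measure_eq_zero_iff_ae_notMem.2 ?_)
    filter_upwards [ae_good hS] with ω hω h
    exact hdk (h.2 k hk ▸ Uproc_sub_mem hω k)
  set A : Set Ω := {ω | (tau S m ω = t ∧ ∀ k ≤ t, S k ω = q k) ∧
        ∀ k < N, Uproc S (k + 1) ω - Uproc S k ω = d k} with hA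
  have hAm : MeasurableSet A := ((measurable_tau hS.1 m (measurableSet_singleton t)).inter
    (measurableSet_hist hS.1 t q)).inter (measurableSet_increments hS.1 N d)
  have hlim : Tendsto
      (fun n => ∫ ω, gain m t q (fun k => S k ω) n * weight N d (fun k => S k ω) n ∂P) atTop
      (nhds (∫ ω, A.indicator (fun ω => (MartM S (m + 1) ω - MartM S m ω) * 4 ^ N) ω ∂P)) := by
    refine tendsto_integral_of_dominated_convergence
      (fun ω => (tau S (m + 1) ω : ℝ) * 4 ^ N) (fun n => ?_)
      ((integrable_tau hS (m + 1)).mul_const _) (fun n => ?_) ?_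
    · exact (measurable_of_congr (Φ := fun p => gain m t q p n * weight N d p n) hS.1
        fun p p' h => by rw [gain_congr h, weight_congr h]).aestronglyMeasurable
    · filter_upwards [ae_good hS] with ω hω
      refine abs_gain_mul_weight_le hω.step n ?_
      rw [← Finset.card_range (tau S (m + 1) ω)]
      refine Finset.card_le_card fun j hj => ?_
      rw [Finset.mem_filter] at hj
      have := tau_le_iff hω.unbounded (m + 1) j
      rw [Finset.mem_range]
      omega
    · filter_upwards [ae_good hS] with ω hω
      refine tendsto_const_nhds.congr' ?_
      filter_upwards [eventually_ge_atTop (tau S m ω), eventually_ge_atTop (tau S (m + 1) ω),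
        eventually_ge_atTop (tau S N ω)] with n h1 h2 h3
      rw [tau_le_iff hω.unbounded] at h3
      rw [gain_eq hω.unbounded, weight_eq hω.unbounded, min_eq_right h1, min_eq_right h2,
        min_eq_right h3, ite_zero_mul_ite_zero, Set.indicator_apply]
      exact if_congr Iff.rfl rfl rfl
  simp only [integral_gain_mul_weight hS m t N q hd] at hlim
  have h0 := tendsto_nhds_unique hlim tendsto_const_nhds
  rw [integral_indicator hAm, integral_mul_const] at h0
  exact (mul_eq_zero.1 h0).resolve_right (by positivity)

theorem measurable_record (hm : ∀ n, Measurable (S n)) (m N : ℕ) :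
    Measurable[_, ⊤] (record S m N) := by
  let _ : MeasurableSpace (ℕ × List Site × List (ℤ × ℤ)) := ⊤
  refine measurable_to_countable fun ω₀ => ?_
  have : record S m N ⁻¹' {record S m N ω₀}
      = {ω | (tau S m ω = tau S m ω₀ ∧ ∀ k ≤ tau S m ω₀, S k ω = S k ω₀) ∧
      ∀ k < N, Uproc S (k + 1) ω - Uproc S k ω = Uproc S (k + 1) ω₀ - Uproc S k ω₀} := by
    ext ω
    exact record_eq_iff
  rw [this]
  exact ((measurable_tau hm m (measurableSet_singleton _)).inter
    (measurableSet_hist hm _ fun k => S k ω₀)).inter (measurableSet_increments hm N _)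

theorem sup_le_iSup_recordSigma (m : ℕ) :
    stoppedSigma S m ⊔ sigmaU S ≤ ⨆ N, recordSigma S m N := by
  have hfac : ∀ {β : Type} [MeasurableSpace β] (N : ℕ)
      (g : ℕ × List Site × List (ℤ × ℤ) → β),
      Measurable[⨆ N, recordSigma S m N] fun ω => g (record S m N ω) := by
    intro β _ N g
    refine Measurable.mono ?_ (le_iSup (recordSigma S m) N) le_rfl
    exact (measurable_from_top (f := g)).comp (comap_measurable (record S m N))
  refine sup_le ?_ ?_
  · refine Measurable.comap_le ?_
    refine @Measurable.prodMk _ (⨆ N, recordSigma S m N) _ _ _ _ _ _ (hfac 0 fun c => c.1) ?_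
    refine @measurable_pi_lambda _ _ _ (⨆ N, recordSigma S m N) _ _ fun k => ?_
    convert hfac 0 fun c => c.2.1.getD (min k c.1) 0 using 2 with ω
    simp only [record]
    rw [List.getD_eq_getElem _ _ (by simp)]
    simp
  · refine Measurable.comap_le
      (@measurable_pi_lambda _ _ _ (⨆ N, recordSigma S m N) _ _ fun k => ?_)
    convert hfac k fun c => c.2.2.getD k 0 using 2 with ω
    simp only [record]
    rw [List.getD_eq_getElem _ _ (by simp)]
    simp

theorem setIntegral_recordSigma [IsProbabilityMeasure P] (hS : IsBERW 4 2 3 P S) {m N : ℕ}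
    {s : Set Ω} (hs : MeasurableSet[recordSigma S m N] s) :
    ∫ ω in s, (MartM S (m + 1) ω - MartM S m ω) ∂P = 0 := by
  obtain ⟨C, -, rfl⟩ := hs
  have hsm : MeasurableSet (record S m N ⁻¹' C) := measurable_record hS.1 m N trivial
  have hm : ∀ ω₀, MeasurableSet {ω | record S m N ω = record S m N ω₀} := fun ω₀ =>
    measurable_record hS.1 m N (t := {record S m N ω₀}) trivial
  have hint : Integrable (fun ω => MartM S (m + 1) ω - MartM S m ω) P :=
    (integrable_MartM hS (m + 1)).sub (integrable_MartM hS m)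
  refine integral_eq_zero_of_fibers (record S m N) hm hint.integrableOn fun ω₀ => ?_
  rw [Measure.restrict_restrict (hm ω₀)]
  by_cases h0 : record S m N ω₀ ∈ C
  · have : {ω | record S m N ω = record S m N ω₀} ∩ record S m N ⁻¹' C
        = {ω | record S m N ω = record S m N ω₀} := by
      refine Set.inter_eq_left.2 fun ω hω => ?_
      rw [Set.mem_preimage, (hω : record S m N ω = _)]
      exact h0
    rw [this]
    simp only [record_eq_iff]
    exact setIntegral_atom hS m (tau S m ω₀) N (fun k => S k ω₀)
      fun k => Uproc S (k + 1) ω₀ - Uproc S k ω₀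
  · have : {ω | record S m N ω = record S m N ω₀} ∩ record S m N ⁻¹' C = ∅ := by
      refine Set.eq_empty_of_forall_notMem fun ω hω => h0 ?_
      rw [← (hω.1 : record S m N ω = _)]
      exact hω.2
    rw [this, setIntegral_empty]

theorem setIntegral_iSup_recordSigma [IsProbabilityMeasure P] (hS : IsBERW 4 2 3 P S) {m : ℕ}
    {s : Set Ω} (hs : MeasurableSet[⨆ N, recordSigma S m N] s) :
    ∫ ω in s, (MartM S (m + 1) ω - MartM S m ω) ∂P = 0 := by
  have hint : Integrable (fun ω => MartM S (m + 1) ω - MartM S m ω) P :=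
    (integrable_MartM hS (m + 1)).sub (integrable_MartM hS m)
  have hle : ⨆ N, recordSigma S m N ≤ ‹MeasurableSpace Ω› :=
    iSup_le fun N => (measurable_record hS.1 m N).comap_le
  have huniv : ∫ ω, (MartM S (m + 1) ω - MartM S m ω) ∂P = 0 := by
    rw [← setIntegral_univ]
    exact setIntegral_recordSigma hS (m := m) (N := 0) MeasurableSet.univ
  have hpi : IsPiSystem (⋃ N, {s | MeasurableSet[recordSigma S m N] s}) :=
    isPiSystem_iUnion_of_monotone _ (fun N => @MeasurableSpace.isPiSystem_measurableSet Ω (recordSigma S m N))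
      fun N N' hN s hs => recordSigma_mono m hN s hs
  induction s, hs using MeasurableSpace.induction_on_inter
    (MeasurableSpace.generateFrom_iUnion_measurableSet (recordSigma S m)).symm hpi with
  | empty => simp
  | basic s hs =>
    obtain ⟨N, hN⟩ := Set.mem_iUnion.1 hs
    exact setIntegral_recordSigma hS hN
  | compl s hs ih =>
    have := integral_add_compl (hle s hs) hint
    linarith
  | iUnion f hd hf ih =>
    rw [integral_iUnion (fun i => hle _ (hf i)) hd hint.integrableOn]
    simp [ih]

theorem stoppedSigma_le (hm : ∀ n, Measurable (S n)) (m : ℕ) :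
    stoppedSigma S m ⊔ sigmaU S ≤ ‹MeasurableSpace Ω› :=
  (sup_le_iSup_recordSigma m).trans (iSup_le fun N => (measurable_record hm m N).comap_le)

theorem measurable_MartM_stoppedSigma (S : ℕ → Ω → Site) (m : ℕ) :
    Measurable[stoppedSigma S m ⊔ sigmaU S] (MartM S m) := by
  refine Measurable.mono ?_ le_sup_left le_rfl
  have hg : Measurable fun x : ℕ × (ℕ → Site) => (x.2 x.1 0 : ℝ) :=
    measurable_from_prod_countable_right fun n =>
      (measurable_of_countable fun x : Site => (x 0 : ℝ)).comp (measurable_pi_apply n)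
  have : MartM S m = (fun x : ℕ × (ℕ → Site) => (x.2 x.1 0 : ℝ)) ∘
      fun ω => (tau S m ω, fun k : ℕ => S (min k (tau S m ω)) ω) := by
    ext ω
    simp [MartM]
  rw [this]
  exact hg.comp (comap_measurable _)

end Conditioning

end BERW

/-- For the `M₄(2,3)` balanced excited random walk `S = (X, Y, Z, W)`, all the
stopping times `τ_k` are a.s. finite and, under the conditional law `P_U`
(equivalently, enlarging each `𝒢_m = 𝔽_{τ_m}` by `σ(U)`), the process
`M_m = X_{τ_m}` is a martingale. -/
theorem berw_M4_2_3_martingale {Ω : Type*} [MeasurableSpace Ω]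
    (P : Measure Ω) [IsProbabilityMeasure P]
    (S : ℕ → Ω → Fin 4 → ℤ) (hS : IsBERW 4 2 3 P S) :
    (∀ᵐ ω ∂P, ∀ k : ℕ, {n : ℕ | tau S k ω < n ∧
        ¬(S n ω 2 = S (n - 1) ω 2 ∧ S n ω 3 = S (n - 1) ω 3)}.Nonempty) ∧
    (∀ m, Measurable[stoppedSigma S m ⊔ sigmaU S] (MartM S m)) ∧
    (∀ m, Integrable (MartM S m) P) ∧
    (∀ m, (P[MartM S (m + 1)|stoppedSigma S m ⊔ sigmaU S]) =ᵐ[P] MartM S m) := by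
  refine ⟨?_, BERW.measurable_MartM_stoppedSigma S, BERW.integrable_MartM hS, fun m => ?_⟩
  · filter_upwards [BERW.ae_good hS] with ω hω
    exact BERW.tau_set_nonempty hω.unbounded
  · refine (ae_eq_condExp_of_forall_setIntegral_eq (BERW.stoppedSigma_le hS.1 m)
      (BERW.integrable_MartM hS (m + 1))
      (fun s _ _ => (BERW.integrable_MartM hS m).integrableOn) (fun s hs _ => ?_)
      (BERW.measurable_MartM_stoppedSigma S m).aestronglyMeasurable).symm
    have h := BERW.setIntegral_iSup_recordSigma hS (BERW.sup_le_iSup_recordSigma m s hs)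
    rw [integral_sub (BERW.integrable_MartM hS (m + 1)).integrableOn
      (BERW.integrable_MartM hS m).integrableOn] at h
    linarith
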